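/- The number of André permutations of the first kind of [n] equals the number of André permutations of the second kind of [n], and both equal the Euler number E_n (the nth coefficient in the Taylor expansion of sec z + tan z). -/

import Mathlib

open Finset
open scoped Classical
noncomputable section

def wrd {n : ℕ} (σ : Equiv.Perm (Fin n)) (i : ℕ) : ℕ :=
  if h : 1 ≤ i ∧ i ≤ n then ((σ ⟨i - 1, by omega⟩ : Fin n) : ℕ) + 1 else 0

/-- positions of λ(x) in the x-factorization at position i: the maximal
contiguous block immediately to the left of i whose letters all exceed σᵢ. -/
def lamB {n : ℕ} (σ : Equiv.Perm (Fin n)) (i : ℕ) : Finset ℕ :=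
  (Finset.Icc 1 n).filter fun j => j < i ∧ ∀ l ∈ Finset.Ico j i, wrd σ i < wrd σ l

/-- positions of ρ(x) in the x-factorization at position i. -/
def rhoB {n : ℕ} (σ : Equiv.Perm (Fin n)) (i : ℕ) : Finset ℕ :=
  (Finset.Icc 1 n).filter fun j => i < j ∧ ∀ l ∈ Finset.Icc (i + 1) j, wrd σ i < wrd σ l

/-- σ has no double descents (with the boundary convention σ₀ = σ_{n+1} = 0). -/
def NoDd {n : ℕ} (σ : Equiv.Perm (Fin n)) : Prop :=
  ∀ i ∈ Finset.Icc 1 n, ¬(wrd σ i < wrd σ (i - 1) ∧ wrd σ (i + 1) < wrd σ i)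

/-- André permutation of the first kind (x-factorization definition):
no double descents; λ(x) is empty whenever ρ(x) is empty; and when both are
nonempty, max λ(x) < max ρ(x). -/
def IsAndreX1 {n : ℕ} (σ : Equiv.Perm (Fin n)) : Prop :=
  NoDd σ ∧ ∀ i ∈ Finset.Icc 1 n,
    (rhoB σ i = ∅ → lamB σ i = ∅) ∧
    (lamB σ i ≠ ∅ → rhoB σ i ≠ ∅ →
      ∃ b ∈ rhoB σ i, ∀ a ∈ lamB σ i, wrd σ a < wrd σ b)

/-- André permutation of the second kind: when both λ(x), ρ(x) are nonempty,
min ρ(x) < min λ(x). -/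
def IsAndreX2 {n : ℕ} (σ : Equiv.Perm (Fin n)) : Prop :=
  NoDd σ ∧ ∀ i ∈ Finset.Icc 1 n,
    (rhoB σ i = ∅ → lamB σ i = ∅) ∧
    (lamB σ i ≠ ∅ → rhoB σ i ≠ ∅ →
      ∃ b ∈ rhoB σ i, ∀ a ∈ lamB σ i, wrd σ b < wrd σ a)

/-- σ is an (increasing) alternating permutation: σ₁ < σ₂ > σ₃ < … -/
def IsAlternating {n : ℕ} (σ : Equiv.Perm (Fin n)) : Prop :=
  ∀ i ∈ Finset.Icc 1 (n - 1),
    (Odd i → wrd σ i < wrd σ (i + 1)) ∧ (Even i → wrd σ (i + 1) < wrd σ i)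

/-- The words using each letter of `S` exactly once and satisfying `P`. -/
def wordsWith {α : Type*} (P : List α → Prop) (S : Finset α) : Finset (List α) :=
  S.val.lists.toFinset.filter P

theorem mem_wordsWith {α : Type*} [DecidableEq α] {P : List α → Prop} {S : Finset α} {l : List α} :
    l ∈ wordsWith P S ↔ (l.Nodup ∧ l.toFinset = S) ∧ P l := by
  simp only [wordsWith, Finset.mem_filter, Multiset.mem_toFinset, Multiset.mem_lists_iff,
    and_congr_left_iff]
  intro _
  constructor
  · intro h
    have hn : l.Nodup := by
      have := S.nodup
      rw [h] at this
      simpa using this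
    refine ⟨hn, ?_⟩
    ext x
    rw [List.mem_toFinset, ← Finset.mem_val, h]
    simp
  · rintro ⟨hn, rfl⟩
    simp [hn.dedup]

theorem card_wordsWith_empty {α : Type*} {P : List α → Prop} (h : P []) :
    (wordsWith P ∅).card = 1 := by
  rw [Finset.card_eq_one]
  refine ⟨[], ?_⟩
  ext l
  simp only [mem_wordsWith, List.toFinset_eq_empty_iff, Finset.mem_singleton]
  constructor
  · exact fun h => h.1.2
  · rintro rfl
    simpa using h

/-- Splitting words at a fixed letter `m`. -/
theorem card_wordsWith_split {α : Type*} [DecidableEq α] {P P₁ P₂ : List α → Prop}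
    {S : Finset α} {m : α}
    (hm : m ∈ S) (C : Finset α → Prop) [DecidablePred C]
    (hP : ∀ u v, u.Nodup → u.toFinset ⊆ S.erase m → v.toFinset = S.erase m \ u.toFinset →
      (P (u ++ m :: v) ↔ C u.toFinset ∧ P₁ u ∧ P₂ v)) :
    (wordsWith P S).card = ∑ T ∈ (S.erase m).powerset with C T,
      (wordsWith P₁ T).card * (wordsWith P₂ (S.erase m \ T)).card := by
  simp_rw [← Finset.card_product]
  rw [← Finset.card_sigma]
  symm
  refine Finset.card_bij (fun x _ => x.2.1 ++ m :: x.2.2) ?_ ?_ ?_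
  · rintro ⟨T, u, v⟩ h
    simp only [Finset.mem_sigma, Finset.mem_filter, Finset.mem_powerset, Finset.mem_product,
      mem_wordsWith] at h ⊢
    obtain ⟨⟨hT, hC⟩, ⟨⟨hu, rfl⟩, hu1⟩, ⟨⟨hv, hvs⟩, hv2⟩⟩ := h
    refine ⟨⟨?_, ?_⟩, (hP u v hu hT hvs).2 ⟨hC, hu1, hv2⟩⟩
    · have hmem : ∀ x, x ∈ v ↔ (x ≠ m ∧ x ∈ S) ∧ x ∉ u := by
        intro x
        rw [← List.mem_toFinset, hvs]
        simp
      have hmu : ∀ x ∈ u, x ≠ m := by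
        intro x hx
        have := hT (List.mem_toFinset.2 hx)
        simp at this
        exact this.1
      rw [List.nodup_append, List.nodup_cons]
      refine ⟨hu, ⟨by simp [hmem], hv⟩, ?_⟩
      intro a ha b hb
      rcases List.mem_cons.1 hb with rfl | hb
      · exact hmu a ha
      · rintro rfl
        exact ((hmem a).1 hb).2 ha
    · ext x
      have hx : x ∈ u → x ≠ m ∧ x ∈ S := by
        intro hx
        simpa using hT (List.mem_toFinset.2 hx)
      have hv : x ∈ v ↔ (x ≠ m ∧ x ∈ S) ∧ x ∉ u := by
        rw [← List.mem_toFinset, hvs]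
        simp
      simp only [List.mem_toFinset, List.mem_append, List.mem_cons]
      by_cases hxm : x = m
      · subst hxm; simp [hm]
      · tauto
  · rintro ⟨T, u, v⟩ h ⟨T', u', v'⟩ h' heq
    simp only [Finset.mem_sigma, Finset.mem_filter, Finset.mem_powerset, Finset.mem_product,
      mem_wordsWith] at h h' heq
    obtain ⟨⟨hT, -⟩, ⟨⟨-, rfl⟩, -⟩, -⟩ := h
    obtain ⟨⟨hT', -⟩, ⟨⟨-, rfl⟩, -⟩, -⟩ := h'
    have hmu : m ∉ u := fun hx => by simpa using hT (List.mem_toFinset.2 hx)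
    have hmu' : m ∉ u' := fun hx => by simpa using hT' (List.mem_toFinset.2 hx)
    obtain ⟨rfl, rfl⟩ : u = u' ∧ v = v' := by
      rcases List.append_eq_append_iff.1 heq with ⟨w, h1, h2⟩ | ⟨w, h1, h2⟩
      · cases w with
        | nil => simp_all
        | cons c w => simp_all
      · cases w with
        | nil => simp_all
        | cons c w => simp_all
    rfl
  · intro l hl
    obtain ⟨⟨hn, rfl⟩, hPl⟩ := mem_wordsWith.1 hl
    obtain ⟨u, v, rfl⟩ := List.append_of_mem (List.mem_toFinset.1 hm)
    obtain ⟨hu, ⟨hmv, hv⟩, hd⟩ := by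
      simpa only [List.nodup_append, List.nodup_cons] using hn
    have hmu : m ∉ u := fun h => hd m h m (by simp) rfl
    have hdisj : ∀ x ∈ u, x ∉ v := fun x hx hx' => hd x hx x (by simp [hx']) rfl
    have h1 : u.toFinset ⊆ (u ++ m :: v).toFinset.erase m := by
      intro x hx
      rw [List.mem_toFinset] at hx
      simp only [Finset.mem_erase, List.mem_toFinset, List.mem_append]
      exact ⟨fun h => hmu (h ▸ hx), Or.inl hx⟩
    have h2 : v.toFinset = (u ++ m :: v).toFinset.erase m \ u.toFinset := by
      ext x
      have := hdisj x
      have : x ∈ v → x ≠ m := fun h h' => hmv (h' ▸ h)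
      simp only [Finset.mem_sdiff, Finset.mem_erase, List.mem_toFinset, List.mem_append,
        List.mem_cons]
      tauto
    obtain ⟨hC, hu1, hv2⟩ := (hP u v hu h1 h2).1 hPl
    refine ⟨⟨u.toFinset, u, v⟩, ?_, rfl⟩
    simp only [Finset.mem_sigma, Finset.mem_filter, Finset.mem_powerset, Finset.mem_product,
      mem_wordsWith]
    exact ⟨⟨h1, hC⟩, ⟨⟨hu, trivial⟩, hu1⟩, ⟨hv, h2⟩, hv2⟩

/-- The Euler numbers, through the recurrence satisfied by André permutations. -/
def eulerNum : ℕ → ℕ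
  | 0 => 1
  | 1 => 1
  | n + 2 => ∑ k : Fin (n + 1), n.choose k * (eulerNum k * eulerNum (n + 1 - k))

theorem eulerNum_add_two (n : ℕ) : eulerNum (n + 2) =
    ∑ k ∈ Finset.range (n + 1), n.choose k * (eulerNum k * eulerNum (n + 1 - k)) := by
  rw [eulerNum, Finset.sum_range]

theorem two_mul_eulerNum (n : ℕ) : 2 * eulerNum (n + 2) =
    ∑ k ∈ Finset.range (n + 2), (n + 1).choose k * (eulerNum k * eulerNum (n + 1 - k)) := by
  rw [Finset.sum_range_succ']
  have h : ∀ k ∈ Finset.range (n + 1),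
      (n + 1).choose (k + 1) * (eulerNum (k + 1) * eulerNum (n + 1 - (k + 1))) =
      n.choose k * (eulerNum (k + 1) * eulerNum (n - k)) +
      n.choose (k + 1) * (eulerNum (k + 1) * eulerNum (n + 1 - (k + 1))) := by
    intro k _
    rw [Nat.choose_succ_succ, add_mul, Nat.add_sub_add_right]
  rw [Finset.sum_congr rfl h, Finset.sum_add_distrib, two_mul, add_assoc]
  congr 1
  · rw [eulerNum_add_two, ← Finset.sum_range_reflect]
    refine Finset.sum_congr rfl fun k hk => ?_
    have hk : k ≤ n := by simpa [Nat.lt_succ_iff] using hk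
    rw [show n + 1 - 1 - k = n - k by omega, Nat.choose_symm hk,
      show n + 1 - (n - k) = k + 1 by omega, mul_comm (eulerNum _)]
  · have := Finset.sum_range_succ' (fun k => n.choose k * (eulerNum k * eulerNum (n + 1 - k)))
      (n + 1)
    rw [Finset.sum_range_succ, ← eulerNum_add_two] at this
    simpa using this

/-- Alternating words, compared through `f`, that start with an ascent. -/
def AltWord {α : Type*} (f : α → ℤ) : List α → Prop
  | [] => True
  | [_] => True
  | x :: y :: l => f x < f y ∧ AltWord (-f) (y :: l)

theorem altWord_cons_cons {α : Type*} (f : α → ℤ) (x y : α) (l : List α) :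
    AltWord f (x :: y :: l) ↔ f x < f y ∧ AltWord (-f) (y :: l) :=
  Iff.rfl

theorem altWord_split {α : Type*} {f : α → ℤ} {m : α} {v : List α} (hv : ∀ x ∈ v, f m < f x)
    (u : List α) (hu : ∀ x ∈ u, f m < f x) :
    (AltWord f (u ++ m :: v) ↔ Even u.length ∧ AltWord f u ∧ AltWord (-f) v) ∧
    (u ++ v ≠ [] →
      (AltWord (-f) (u ++ m :: v) ↔ Odd u.length ∧ AltWord (-f) u ∧ AltWord (-f) v)) := by
  induction u with
  | nil => cases v with
    | nil => simp [AltWord]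
    | cons y v =>
      have := hv y (by simp)
      simp [AltWord, this, this.le]
  | cons x u ih =>
    have hx := hu x (by simp)
    have ih := ih fun y hy => hu y (by simp [hy])
    cases u with
    | nil =>
      simp only [List.nil_append, List.length_nil, Even.zero, true_and] at ih
      simp [AltWord, hx, hx.le, ih.1, - Nat.not_even_iff_odd]
    | cons y u =>
      have ih2 := ih.2 (by simp)
      have ih1 := ih.1
      simp only [List.cons_append, List.length_cons] at ih1 ih2 ⊢
      rw [Nat.even_add_one (n := u.length + 1), Nat.odd_add_one (n := u.length + 1),
        Nat.not_even_iff_odd, Nat.not_odd_iff_even, altWord_cons_cons, altWord_cons_cons,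
        altWord_cons_cons, altWord_cons_cons, neg_neg, ih1, ih2]
      exact ⟨by rw [and_assoc, and_left_comm], fun _ => by rw [and_assoc, and_left_comm]⟩

theorem altWord_iff {α : Type*} (l : List α) (f : α → ℤ) : AltWord f l ↔
    ∀ i (h : i + 1 < l.length),
      (Even i → f l[i] < f l[i + 1]) ∧ (Odd i → f l[i + 1] < f l[i]) := by
  induction l generalizing f with
  | nil => simp [AltWord]
  | cons x l ih => cases l with
    | nil => simp [AltWord]
    | cons y l =>
      simp only [AltWord, ih]
      constructor
      · rintro ⟨h1, h2⟩ i h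
        cases i with
        | zero => simpa using h1
        | succ i =>
          have := h2 i (by simpa using h)
          simp only [List.getElem_cons_succ, Pi.neg_apply, neg_lt_neg_iff] at this ⊢
          rw [Nat.even_add_one, Nat.odd_add_one, Nat.not_even_iff_odd, Nat.not_odd_iff_even]
          exact this.symm
      · intro h
        refine ⟨by simpa using h 0 (by simp), fun i hi => ?_⟩
        have := h (i + 1) (by simpa using hi)
        simp only [List.getElem_cons_succ, Pi.neg_apply, neg_lt_neg_iff] at this ⊢
        rw [Nat.even_add_one, Nat.odd_add_one, Nat.not_even_iff_odd, Nat.not_odd_iff_even] at this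
        exact this.symm

/-- The words all of whose letters `x` satisfy `λ(x) = ∅` or `g` on `λ(x)` is bounded by
a value of `g` on `ρ(x)`; letters are compared through `f`. -/
def AndreWord {α : Type*} (f g : α → ℤ) (l : List α) : Prop :=
  ∀ a x b, l = a ++ x :: b →
    a.reverse.takeWhile (fun y => f x < f y) = [] ∨
      ∃ y ∈ b.takeWhile (fun y => f x < f y),
        ∀ z ∈ a.reverse.takeWhile (fun y => f x < f y), g z < g y

theorem takeWhile_append_cons_of_neg {α : Type*} {p : α → Bool} {m : α}
    (a b : List α) (hm : ¬p m) : (a ++ m :: b).takeWhile p = a.takeWhile p := by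
  induction a with
  | nil => simp [hm]
  | cons x a ih => simp only [List.cons_append, List.takeWhile_cons, ih]

theorem andreWord_split {α : Type*} {f g : α → ℤ} {m : α} {u v : List α}
    (hu : ∀ x ∈ u, f m < f x) (hv : ∀ x ∈ v, f m < f x) :
    AndreWord f g (u ++ m :: v) ↔
      (u = [] ∨ ∃ y ∈ v, ∀ z ∈ u, g z < g y) ∧ AndreWord f g u ∧ AndreWord f g v := by
  have hru : u.reverse.takeWhile (fun y => f m < f y) = u.reverse :=
    List.takeWhile_eq_self_iff.2 (by simpa using hu)
  have hrv : v.takeWhile (fun y => f m < f y) = v :=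
    List.takeWhile_eq_self_iff.2 (by simpa using hv)
  constructor
  · intro h
    refine ⟨?_, ?_, ?_⟩
    · simpa [hru, hrv] using h u m v rfl
    · rintro a x b rfl
      have hx := hu x (by simp)
      have := h a x (b ++ m :: v) (by simp)
      rwa [takeWhile_append_cons_of_neg _ _ (by simpa using hx.le)] at this
    · rintro a x b rfl
      have hx := hv x (by simp)
      have := h (u ++ m :: a) x b (by simp)
      rwa [List.reverse_append, List.reverse_cons, List.append_assoc, List.singleton_append,
        takeWhile_append_cons_of_neg _ _ (by simpa using hx.le)] at this
  · rintro ⟨hC, h1, h2⟩ a x b h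
    rcases List.append_eq_append_iff.1 h with ⟨w, rfl, h'⟩ | ⟨w, rfl, h'⟩
    · cases w with
      | nil =>
        simp only [List.nil_append, List.cons.injEq] at h'
        obtain ⟨rfl, rfl⟩ := h'
        simpa [hru, hrv] using hC
      | cons c w =>
        simp only [List.cons_append, List.cons.injEq] at h'
        obtain ⟨rfl, rfl⟩ := h'
        have hx := hv x (by simp)
        rw [List.reverse_append, List.reverse_cons, List.append_assoc, List.singleton_append,
          takeWhile_append_cons_of_neg _ _ (by simpa using hx.le)]
        exact h2 w x b rfl
    · cases w with
      | nil =>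
        simp only [List.nil_append, List.cons.injEq] at h'
        obtain ⟨rfl, rfl⟩ := h'
        simp only [List.append_nil] at hC hru ⊢
        simpa [hru, hrv] using hC
      | cons c w =>
        simp only [List.cons_append, List.cons.injEq] at h'
        obtain ⟨rfl, rfl⟩ := h'
        have hx := hu x (by simp)
        rw [takeWhile_append_cons_of_neg _ _ (by simpa using hx.le)]
        exact h1 a x w rfl

theorem card_wordsWith_andreWord {α : Type*} {f g : α → ℤ} (hf : f.Injective)
    (hg : g.Injective) (n : ℕ) (S : Finset α) (hS : S.card = n) :
    (wordsWith (AndreWord f g) S).card = eulerNum n := by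
  induction n using Nat.strong_induction_on generalizing S with
  | _ n ih =>
  rcases S.eq_empty_or_nonempty with rfl | hne
  · subst hS
    rw [card_wordsWith_empty (by simp [AndreWord]), Finset.card_empty, eulerNum]
  obtain ⟨m, hm, hmin⟩ := S.exists_min_image f hne
  have hlt : ∀ x ∈ S.erase m, f m < f x := fun x hx =>
    lt_of_le_of_ne (hmin x (Finset.mem_of_mem_erase hx))
      fun h => Finset.ne_of_mem_erase hx (hf h).symm
  obtain ⟨C, hCdef⟩ : ∃ C : Finset α → Prop,
      ∀ T, C T ↔ T = ∅ ∨ ∃ y ∈ S.erase m \ T, ∀ z ∈ T, g z < g y := ⟨_, fun _ => Iff.rfl⟩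
  rw [card_wordsWith_split (P₁ := AndreWord f g) (P₂ := AndreWord f g) hm C]
  · have hc : (S.erase m).card = n - 1 := by rw [Finset.card_erase_of_mem hm, hS]
    have hpos : 0 < n := hS ▸ hne.card_pos
    rcases n with _ | _ | n
    · omega
    · have : S.erase m = ∅ := Finset.card_eq_zero.1 hc
      rw [this]
      have h0 := ih 0 (by simp) ∅ rfl
      simp [eulerNum, Finset.filter_singleton, hCdef, h0]
    · have hne' : (S.erase m).Nonempty := Finset.card_pos.1 (by omega)
      obtain ⟨M, hM, hmax⟩ := (S.erase m).exists_max_image g hne'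
      have hC : (S.erase m).powerset.filter C = ((S.erase m).erase M).powerset := by
        ext T
        simp only [Finset.mem_filter, Finset.mem_powerset, hCdef,
          Finset.subset_erase (s := T) (a := M)]
        refine and_congr_right fun hT => ⟨?_, fun h => Or.inr ⟨M, ?_, fun z hz => ?_⟩⟩
        · rintro (rfl | ⟨y, hy, h⟩) hMT
          · simp at hMT
          · exact (h M hMT).not_ge (hmax y (Finset.mem_sdiff.1 hy).1)
        · exact Finset.mem_sdiff.2 ⟨hM, h⟩
        · exact lt_of_le_of_ne (hmax z (hT hz)) fun hzM => h (hg hzM ▸ hz)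
      have hcM : ((S.erase m).erase M).card = n := by
        rw [Finset.card_erase_of_mem hM, hc]; rfl
      rw [hC, eulerNum_add_two]
      have := Finset.sum_powerset_apply_card
        (x := (S.erase m).erase M) (fun k => eulerNum k * eulerNum (n + 1 - k))
      rw [hcM] at this
      simp only [smul_eq_mul] at this
      rw [← this]
      refine Finset.sum_congr rfl fun T hT => ?_
      have hT := Finset.mem_powerset.1 hT
      have h1 := Finset.card_le_card hT
      have h2 := Finset.card_sdiff_of_subset (hT.trans (Finset.erase_subset _ _))
      rw [ih T.card (by omega) T rfl, ih (n + 1 - T.card) (by omega) _ (by omega)]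
  · intro u v _ hu hv
    rw [andreWord_split (fun x hx => hlt x (hu (List.mem_toFinset.2 hx)))
      (fun x hx => hlt x ((hv ▸ Finset.sdiff_subset) (List.mem_toFinset.2 hx))), hCdef, ← hv]
    simp

theorem card_wordsWith_altWord_eq_sum {α : Type*} {f : α → ℤ} (n : ℕ) (e : ℕ → ℕ)
    (ih : ∀ k < n + 2, ∀ f : α → ℤ, f.Injective → ∀ S : Finset α, S.card = k →
      (wordsWith (AltWord f) S).card = e k)
    (hf : f.Injective) (S : Finset α) (hS : S.card = n + 2) :
    (wordsWith (AltWord f) S).card = ∑ k ∈ Finset.range (n + 2),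
      (n + 1).choose k * (if Even k then e k * e (n + 1 - k) else 0) ∧
    (wordsWith (AltWord (-f)) S).card = ∑ k ∈ Finset.range (n + 2),
      (n + 1).choose k * (if Odd k then e k * e (n + 1 - k) else 0) := by
  have hf' : (-f).Injective := fun x y h => hf (by simpa using h)
  obtain ⟨m, hm, hmin⟩ := S.exists_min_image f (Finset.card_pos.1 (by omega))
  have hlt : ∀ x ∈ S.erase m, f m < f x := fun x hx =>
    lt_of_le_of_ne (hmin x (Finset.mem_of_mem_erase hx))
      fun h => Finset.ne_of_mem_erase hx (hf h).symm
  have hc : (S.erase m).card = n + 1 := by rw [Finset.card_erase_of_mem hm, hS]; rfl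
  have hsum (p : ℕ → Prop) [DecidablePred p] (h : α → ℤ) (hh : h.Injective) :
      ∑ T ∈ (S.erase m).powerset with p T.card,
        (wordsWith (AltWord h) T).card * (wordsWith (AltWord (-f)) (S.erase m \ T)).card =
      ∑ k ∈ Finset.range (n + 2),
        (n + 1).choose k * (if p k then e k * e (n + 1 - k) else 0) := by
    have := Finset.sum_powerset_apply_card
      (x := S.erase m) (fun k => if p k then e k * e (n + 1 - k) else 0)
    rw [hc] at this
    simp only [smul_eq_mul] at this
    rw [← this, Finset.sum_filter]
    refine Finset.sum_congr rfl fun T hT => ?_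
    have hT := Finset.mem_powerset.1 hT
    have h1 := Finset.card_le_card hT
    have h2 := Finset.card_sdiff_of_subset hT
    rw [ih T.card (by omega) h hh T rfl, ih (n + 1 - T.card) (by omega) _ hf' _ (by omega)]
  rw [← hsum Even f hf, ← hsum Odd (-f) hf']
  constructor
  · refine card_wordsWith_split hm (fun T => Even T.card) fun u v hn hu hv => ?_
    rw [List.toFinset_card_of_nodup hn]
    exact (altWord_split (fun x hx => hlt x ((hv ▸ Finset.sdiff_subset) (List.mem_toFinset.2 hx)))
      u (fun x hx => hlt x (hu (List.mem_toFinset.2 hx)))).1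
  · refine card_wordsWith_split hm (fun T => Odd T.card) fun u v hn hu hv => ?_
    rw [List.toFinset_card_of_nodup hn]
    refine (altWord_split (fun x hx => hlt x ((hv ▸ Finset.sdiff_subset) (List.mem_toFinset.2 hx)))
      u (fun x hx => hlt x (hu (List.mem_toFinset.2 hx)))).2 fun h => ?_
    obtain ⟨rfl, rfl⟩ := List.append_eq_nil_iff.1 h
    simp only [List.toFinset_nil, Finset.sdiff_empty] at hv
    rw [← hv] at hc
    simp at hc

theorem card_wordsWith_altWord {α : Type*} (n : ℕ) (f : α → ℤ) (hf : f.Injective)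
    (S : Finset α) (hS : S.card = n) :
    (wordsWith (AltWord f) S).card = eulerNum n := by
  induction n using Nat.strong_induction_on generalizing f S with
  | _ n ih =>
  rcases n with _ | _ | n
  · obtain rfl := Finset.card_eq_zero.1 hS
    rw [card_wordsWith_empty (by simp [AltWord]), eulerNum]
  · obtain ⟨a, rfl⟩ := Finset.card_eq_one.1 hS
    rw [eulerNum, Finset.card_eq_one]
    refine ⟨[a], ?_⟩
    ext l
    rw [mem_wordsWith, Finset.mem_singleton]
    constructor
    · rintro ⟨⟨hn, hl⟩, -⟩
      have h1 : l.length = 1 := by rw [← List.toFinset_card_of_nodup hn, hl, hS]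
      obtain ⟨b, rfl⟩ := List.length_eq_one_iff.1 h1
      simpa using hl
    · rintro rfl
      simp [AltWord]
  · have hf' : (-f).Injective := fun x y h => hf (by simpa using h)
    obtain ⟨h1, h2⟩ := card_wordsWith_altWord_eq_sum n eulerNum
      (fun k hk f hf S hS => ih k hk f hf S hS) hf S hS
    have h3 := (card_wordsWith_altWord_eq_sum n eulerNum
      (fun k hk f hf S hS => ih k hk f hf S hS) hf' S hS).1
    have h4 := two_mul_eulerNum n
    have h5 : ∀ k, (n + 1).choose k * (eulerNum k * eulerNum (n + 1 - k)) =
        (n + 1).choose k * (if Even k then eulerNum k * eulerNum (n + 1 - k) else 0) +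
        (n + 1).choose k * (if Odd k then eulerNum k * eulerNum (n + 1 - k) else 0) := by
      intro k
      rcases Nat.even_or_odd k with hk | hk
      · simp [hk, Nat.not_odd_iff_even.2 hk]
      · simp [hk, Nat.not_even_iff_odd.2 hk]
    simp_rw [h5] at h4
    rw [Finset.sum_add_distrib, ← h1, ← h2] at h4
    change _ = eulerNum (n + 2)
    omega

theorem card_perm_filter_eq {n : ℕ} (P : Equiv.Perm (Fin n) → Prop) (Q : List (Fin n) → Prop)
    (h : ∀ σ : Equiv.Perm (Fin n), P σ ↔ Q (List.ofFn σ)) :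
    (Finset.univ.filter P).card = (wordsWith Q Finset.univ).card := by
  refine Finset.card_bij (fun σ _ => List.ofFn σ) ?_ ?_ ?_
  · intro σ hσ
    rw [mem_wordsWith]
    refine ⟨⟨List.nodup_ofFn.2 σ.injective, ?_⟩, (h σ).1 (Finset.mem_filter.1 hσ).2⟩
    ext x
    simp [List.mem_ofFn, σ.surjective x]
  · intro σ _ τ _ hστ
    exact Equiv.coe_fn_injective (List.ofFn_injective hστ)
  · intro l hl
    obtain ⟨⟨hn, hl⟩, hQ⟩ := mem_wordsWith.1 hl
    have hlen : l.length = n := by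
      rw [← List.toFinset_card_of_nodup hn, hl, Finset.card_univ, Fintype.card_fin]
    have hinj : Function.Injective fun i : Fin n => l.get (i.cast hlen.symm) := fun i j hij => by
      simpa using hn.injective_get hij
    have heq : List.ofFn (Equiv.ofBijective _ (Finite.injective_iff_bijective.1 hinj)) = l := by
      apply List.ext_getElem
      · simp [hlen]
      · intro i _ _
        simp
    exact ⟨_, Finset.mem_filter.2 ⟨Finset.mem_univ _, (h _).2 (heq.symm ▸ hQ)⟩, heq⟩

theorem wrd_succ {n : ℕ} (σ : Equiv.Perm (Fin n)) {i : ℕ} (hi : i < n) :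
    wrd σ (i + 1) = (σ ⟨i, hi⟩ : ℕ) + 1 := by
  simp [wrd, Nat.succ_le_of_lt hi]

theorem isAlternating_iff {n : ℕ} (σ : Equiv.Perm (Fin n)) :
    IsAlternating σ ↔ AltWord (fun x : Fin n => (x : ℤ)) (List.ofFn σ) := by
  rw [altWord_iff]
  constructor
  · intro h i hi
    have hi' : i + 1 < n := by simpa using hi
    have := h (i + 1) (Finset.mem_Icc.2 (by omega))
    rw [wrd_succ σ hi', wrd_succ σ (by omega : i < n), Nat.even_add_one, Nat.odd_add_one,
      Nat.not_even_iff_odd, Nat.not_odd_iff_even] at this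
    simpa using this
  · intro h i hi
    rw [Finset.mem_Icc] at hi
    obtain ⟨i, rfl⟩ := Nat.exists_eq_add_of_le' hi.1
    have := h i (by simp; omega)
    rw [wrd_succ σ (by omega : i + 1 < n), wrd_succ σ (by omega : i < n), Nat.even_add_one,
      Nat.odd_add_one, Nat.not_even_iff_odd, Nat.not_odd_iff_even]
    simpa using this

theorem mem_takeWhile_iff_getElem {α : Type*} {p : α → Bool} {b : List α} {z : α} :
    z ∈ b.takeWhile p ↔ ∃ k, ∃ h : k < b.length, b[k] = z ∧ ∀ k' (_ : k' ≤ k), p b[k'] := by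
  induction b with
  | nil => simp
  | cons x b ih =>
    rw [List.takeWhile_cons]
    by_cases hx : p x
    · rw [if_pos hx, List.mem_cons, ih]
      constructor
      · rintro (rfl | ⟨k, hk, rfl, h⟩)
        · exact ⟨0, by simp, rfl, fun k' hk' => by simpa [Nat.le_zero.1 hk'] using hx⟩
        · refine ⟨k + 1, by simpa using hk, by simp, fun k' hk' => ?_⟩
          cases k' with
          | zero => simpa using hx
          | succ k' => simpa using h k' (by omega)
      · rintro ⟨k, hk, hz, h⟩
        cases k with
        | zero => exact Or.inl (by simpa using hz.symm)
        | succ k =>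
          refine Or.inr ⟨k, by simpa using hk, by simpa using hz, fun k' hk' => ?_⟩
          simpa using h (k' + 1) (by omega)
    · rw [if_neg hx]
      simp only [List.not_mem_nil, false_iff]
      rintro ⟨k, hk, -, h⟩
      exact hx (by simpa using h 0 (by omega))

theorem mem_takeWhile_drop_iff {n : ℕ} (σ : Equiv.Perm (Fin n)) {i : ℕ} (hi : i < n)
    (z : Fin n) :
    z ∈ ((List.ofFn σ).drop (i + 1)).takeWhile
        (fun y => ((σ ⟨i, hi⟩ : Fin n) : ℤ) < ((y : Fin n) : ℤ)) ↔
      ∃ j ∈ rhoB σ (i + 1), wrd σ j = z + 1 := by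
  rw [mem_takeWhile_iff_getElem]
  simp only [rhoB, Finset.mem_filter, Finset.mem_Icc, wrd_succ σ hi, List.length_drop,
    List.length_ofFn, List.getElem_drop, List.getElem_ofFn, decide_eq_true_eq]
  constructor
  · rintro ⟨k, hk, rfl, h⟩
    refine ⟨i + 1 + k + 1, ⟨by omega, by omega, fun l hl => ?_⟩, wrd_succ σ (by omega)⟩
    obtain ⟨t, rfl⟩ := Nat.exists_eq_add_of_le hl.1
    rw [add_right_comm, wrd_succ σ (by omega)]
    have := h t (by omega)
    omega
  · rintro ⟨j, ⟨hj, hij, h⟩, hz⟩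
    obtain ⟨k, rfl⟩ : ∃ k, j = i + 1 + k + 1 := ⟨j - (i + 2), by omega⟩
    rw [wrd_succ σ (by omega)] at hz
    refine ⟨k, by omega, Fin.ext (by omega), fun k' hk' => ?_⟩
    have := h (i + 1 + k' + 1) (by omega)
    rw [wrd_succ σ (by omega)] at this
    omega

theorem mem_takeWhile_take_iff {n : ℕ} (σ : Equiv.Perm (Fin n)) {i : ℕ} (hi : i < n)
    (z : Fin n) :
    z ∈ ((List.ofFn σ).take i).reverse.takeWhile
        (fun y => ((σ ⟨i, hi⟩ : Fin n) : ℤ) < ((y : Fin n) : ℤ)) ↔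
      ∃ j ∈ lamB σ (i + 1), wrd σ j = z + 1 := by
  rw [mem_takeWhile_iff_getElem]
  simp only [lamB, Finset.mem_filter, Finset.mem_Icc, Finset.mem_Ico, wrd_succ σ hi,
    List.length_reverse, List.length_take, List.getElem_reverse, List.getElem_take,
    List.length_ofFn, List.getElem_ofFn, decide_eq_true_eq, min_eq_left hi.le]
  constructor
  · rintro ⟨k, hk, rfl, h⟩
    refine ⟨i - 1 - k + 1, ⟨by omega, by omega, fun l hl => ?_⟩, wrd_succ σ (by omega)⟩
    obtain ⟨t, rfl⟩ : ∃ t, l = i - 1 - t + 1 := ⟨i - l, by omega⟩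
    rw [wrd_succ σ (by omega)]
    by_cases ht : t ≤ k
    · have := h t ht
      omega
    · have := h k le_rfl
      simp only [show i - 1 - t = i - 1 - k by omega]
      omega
  · rintro ⟨j, ⟨hj, hij, h⟩, hz⟩
    obtain ⟨k, hk, rfl⟩ : ∃ k, k < i ∧ j = i - 1 - k + 1 := ⟨i - j, by omega, by omega⟩
    rw [wrd_succ σ (by omega)] at hz
    refine ⟨k, by omega, Fin.ext (by omega), fun k' hk' => ?_⟩
    have := h (i - 1 - k' + 1) (by omega)
    rw [wrd_succ σ (by omega)] at this
    omega

theorem lamB_subset {n : ℕ} (σ : Equiv.Perm (Fin n)) (i : ℕ) : lamB σ i ⊆ Finset.Icc 1 n := by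
  intro j hj
  simp only [lamB, Finset.mem_filter] at hj
  exact hj.1

theorem rhoB_subset {n : ℕ} (σ : Equiv.Perm (Fin n)) (i : ℕ) : rhoB σ i ⊆ Finset.Icc 1 n := by
  intro j hj
  simp only [rhoB, Finset.mem_filter] at hj
  exact hj.1

theorem exists_wrd_eq {n : ℕ} (σ : Equiv.Perm (Fin n)) {j : ℕ} (hj : j ∈ Finset.Icc 1 n) :
    ∃ z : Fin n, wrd σ j = z + 1 := by
  rw [Finset.mem_Icc] at hj
  obtain ⟨j, rfl⟩ := Nat.exists_eq_add_of_le' hj.1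
  exact ⟨_, wrd_succ σ (by omega)⟩

theorem andreWord_ofFn_iff {n : ℕ} (σ : Equiv.Perm (Fin n)) (g : Fin n → ℤ) (G : ℕ → ℤ)
    (hG : ∀ x : Fin n, G (x + 1) = g x) :
    AndreWord (fun x : Fin n => (x : ℤ)) g (List.ofFn σ) ↔ ∀ i ∈ Finset.Icc 1 n,
      lamB σ i = ∅ ∨ ∃ b ∈ rhoB σ i, ∀ a ∈ lamB σ i, G (wrd σ a) < G (wrd σ b) := by
  have key (i : ℕ) (hi : i < n) :
      (((List.ofFn σ).take i).reverse.takeWhile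
          (fun y => ((σ ⟨i, hi⟩ : Fin n) : ℤ) < ((y : Fin n) : ℤ)) = [] ∨
        ∃ y ∈ ((List.ofFn σ).drop (i + 1)).takeWhile
            (fun y => ((σ ⟨i, hi⟩ : Fin n) : ℤ) < ((y : Fin n) : ℤ)),
          ∀ z ∈ ((List.ofFn σ).take i).reverse.takeWhile
            (fun y => ((σ ⟨i, hi⟩ : Fin n) : ℤ) < ((y : Fin n) : ℤ)), g z < g y) ↔
      (lamB σ (i + 1) = ∅ ∨
        ∃ b ∈ rhoB σ (i + 1), ∀ a ∈ lamB σ (i + 1), G (wrd σ a) < G (wrd σ b)) := by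
    simp only [List.eq_nil_iff_forall_not_mem, Finset.eq_empty_iff_forall_notMem,
      mem_takeWhile_drop_iff σ hi, mem_takeWhile_take_iff σ hi]
    refine or_congr ⟨fun h j hj => ?_, ?_⟩ ⟨?_, ?_⟩
    · obtain ⟨z, hz⟩ := exists_wrd_eq σ (lamB_subset σ _ hj)
      exact h z ⟨j, hj, hz⟩
    · rintro h z ⟨j, hj, -⟩
      exact h j hj
    · rintro ⟨y, ⟨b, hb, hy⟩, h⟩
      refine ⟨b, hb, fun a ha => ?_⟩
      obtain ⟨z, hz⟩ := exists_wrd_eq σ (lamB_subset σ _ ha)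
      rw [hy, hz, hG, hG]
      exact h z ⟨a, ha, hz⟩
    · rintro ⟨b, hb, h⟩
      obtain ⟨y, hy⟩ := exists_wrd_eq σ (rhoB_subset σ _ hb)
      refine ⟨y, ⟨b, hb, hy⟩, ?_⟩
      rintro z ⟨a, ha, hz⟩
      rw [← hG, ← hG, ← hy, ← hz]
      exact h a ha
  constructor
  · intro h i hi
    rw [Finset.mem_Icc] at hi
    obtain ⟨i, rfl⟩ := Nat.exists_eq_add_of_le' hi.1
    have hin : i < n := by omega
    refine (key i hin).1 (h _ _ _ ?_)
    have hl : i < (List.ofFn σ).length := by simpa using hin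
    have := List.take_append_drop i (List.ofFn σ)
    rw [List.drop_eq_getElem_cons hl, List.getElem_ofFn] at this
    exact this.symm
  · intro h a x b hl
    have hlen := congrArg List.length hl
    simp only [List.length_ofFn, List.length_append, List.length_cons] at hlen
    have hin : a.length < n := by omega
    have hk := (key a.length hin).2 (h _ (Finset.mem_Icc.2 (by omega)))
    have hx : σ ⟨a.length, hin⟩ = x := by
      have : (List.ofFn σ)[a.length]'(by simpa using hin) = x := by simp [hl]
      simpa using this
    have ha : (List.ofFn σ).take a.length = a := by simp [hl]
    have hb : (List.ofFn σ).drop (a.length + 1) = b := by simp [hl]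
    rwa [ha, hb, hx] at hk

theorem noDd_of_lamB_eq_empty {n : ℕ} {σ : Equiv.Perm (Fin n)}
    (h : ∀ i ∈ Finset.Icc 1 n, rhoB σ i = ∅ → lamB σ i = ∅) : NoDd σ := by
  rintro i hi ⟨h1, h2⟩
  have hi' := Finset.mem_Icc.1 hi
  have hrho : rhoB σ i = ∅ := by
    refine Finset.eq_empty_of_forall_notMem fun j hj => ?_
    simp only [rhoB, Finset.mem_filter, Finset.mem_Icc] at hj
    exact h2.not_gt (hj.2.2 (i + 1) (by omega))
  have hi1 : 1 ≤ i - 1 := by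
    by_contra hc
    rw [show i - 1 = 0 by omega] at h1
    simp [wrd] at h1
  refine Finset.notMem_empty (i - 1) (h i hi hrho ▸ ?_)
  simp only [lamB, Finset.mem_filter, Finset.mem_Icc, Finset.mem_Ico]
  refine ⟨by omega, by omega, fun l hl => ?_⟩
  rwa [show l = i - 1 by omega]

theorem noDd_and_iff {n : ℕ} (σ : Equiv.Perm (Fin n)) (R : ℕ → ℕ → Prop) :
    (NoDd σ ∧ ∀ i ∈ Finset.Icc 1 n, (rhoB σ i = ∅ → lamB σ i = ∅) ∧
      (lamB σ i ≠ ∅ → rhoB σ i ≠ ∅ → ∃ b ∈ rhoB σ i, ∀ a ∈ lamB σ i, R (wrd σ a) (wrd σ b))) ↔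
    ∀ i ∈ Finset.Icc 1 n,
      lamB σ i = ∅ ∨ ∃ b ∈ rhoB σ i, ∀ a ∈ lamB σ i, R (wrd σ a) (wrd σ b) := by
  constructor
  · rintro ⟨-, h⟩ i hi
    by_cases hl : lamB σ i = ∅
    · exact Or.inl hl
    · exact Or.inr ((h i hi).2 hl fun hr => hl ((h i hi).1 hr))
  · intro h
    have hr : ∀ i ∈ Finset.Icc 1 n, rhoB σ i = ∅ → lamB σ i = ∅ := fun i hi hr =>
      (h i hi).resolve_right (by simp [hr])
    exact ⟨noDd_of_lamB_eq_empty hr, fun i hi =>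
      ⟨hr i hi, fun hl _ => (h i hi).resolve_left hl⟩⟩

theorem isAndreX1_iff {n : ℕ} (σ : Equiv.Perm (Fin n)) :
    IsAndreX1 σ ↔
      AndreWord (fun x : Fin n => (x : ℤ)) (fun x : Fin n => (x : ℤ)) (List.ofFn σ) := by
  rw [andreWord_ofFn_iff σ _ (fun k => (k : ℤ) - 1) (by simp)]
  refine (noDd_and_iff σ (· < ·)).trans ?_
  simp

theorem isAndreX2_iff {n : ℕ} (σ : Equiv.Perm (Fin n)) :
    IsAndreX2 σ ↔
      AndreWord (fun x : Fin n => (x : ℤ)) (fun x : Fin n => -(x : ℤ)) (List.ofFn σ) := by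
  rw [andreWord_ofFn_iff σ _ (fun k => 1 - (k : ℤ)) (by simp)]
  refine (noDd_and_iff σ (· > ·)).trans ?_
  simp

/-- The numbers of André permutations of the first and of the second kind of [n]
agree, and both equal the Euler number E_n, the number of alternating
permutations of [n]. -/
theorem andre_count_euler (n : ℕ) :
    (Finset.univ.filter fun σ : Equiv.Perm (Fin n) => IsAndreX1 σ).card =
      (Finset.univ.filter fun σ : Equiv.Perm (Fin n) => IsAndreX2 σ).card ∧
    (Finset.univ.filter fun σ : Equiv.Perm (Fin n) => IsAndreX1 σ).card =
      (Finset.univ.filter fun σ : Equiv.Perm (Fin n) => IsAlternating σ).card := by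
  have hinj : Function.Injective fun x : Fin n => (x : ℤ) := fun x y h => by
    simpa [Fin.ext_iff] using h
  have hneg : Function.Injective fun x : Fin n => -(x : ℤ) := fun x y h => hinj (by simpa using h)
  rw [card_perm_filter_eq _ _ isAndreX1_iff, card_perm_filter_eq _ _ isAndreX2_iff,
    card_perm_filter_eq _ _ isAlternating_iff,
    card_wordsWith_andreWord hinj hinj _ _ rfl, card_wordsWith_andreWord hinj hneg _ _ rfl,
    card_wordsWith_altWord _ _ hinj _ rfl]
  exact ⟨rfl, rfl⟩
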